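/- Let n ≥ 1 be an integer, let a₁, a₂, c₁, c₂ be integers coprime to 3, and let α₁, α₂, γ₁, γ₂ be nonnegative integers with α₁ + γ₁ < n and α₂ + γ₂ < n. Then it is impossible that both 3^{α₁+γ₁}·a₁c₁ ≡ 3·3^{α₂+γ₂}·a₂c₂ (mod 3^n) and 3·3^{α₂+γ₂}·a₂c₂ ≡ −(3^{α₁+γ₂}·a₁c₂ + 3^{α₂+γ₁}·a₂c₁) (mod 3^n). -/

import Mathlib

theorem le_of_pow_dvd_pow_mul {p u : ℤ} (hp : p ≠ 0) (hu : ¬ p ∣ u) {k m : ℕ}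
    (h : p ^ k ∣ p ^ m * u) : k ≤ m := by
  by_contra! hmk
  have h' : p ^ m * p ∣ p ^ m * u := pow_succ p m ▸ (pow_dvd_pow p hmk).trans h
  exact hu ((mul_dvd_mul_iff_left (pow_ne_zero m hp)).1 h')

theorem le_of_pow_dvd_pow_mul_add_pow_mul {p u : ℤ} (hp : p ≠ 0) (hu : ¬ p ∣ u) (v : ℤ)
    {k m l : ℕ} (hml : m < l) (h : p ^ k ∣ p ^ m * u + p ^ l * v) : k ≤ m := by
  by_contra! hmk
  have h' : p ^ (m + 1) ∣ p ^ m * u :=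
    (dvd_add_left ((pow_dvd_pow p hml).mul_right v)).1 ((pow_dvd_pow p hmk).trans h)
  exact absurd (le_of_pow_dvd_pow_mul hp hu h') m.not_succ_le_self

/-- Cartan type `G₂` cannot occur over `ℤ/3ⁿ`. -/
theorem stmt12 (n : ℕ) (hn : 1 ≤ n)
    (a₁ a₂ c₁ c₂ : ℤ)
    (ha₁ : ¬ (3 : ℤ) ∣ a₁) (ha₂ : ¬ (3 : ℤ) ∣ a₂)
    (hc₁ : ¬ (3 : ℤ) ∣ c₁) (hc₂ : ¬ (3 : ℤ) ∣ c₂)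
    (α₁ α₂ γ₁ γ₂ : ℕ) (h₁ : α₁ + γ₁ < n) (h₂ : α₂ + γ₂ < n) :
    ¬ ((3 : ℤ) ^ (α₁ + γ₁) * (a₁ * c₁) ≡
        3 * ((3 : ℤ) ^ (α₂ + γ₂) * (a₂ * c₂)) [ZMOD (3 : ℤ) ^ n] ∧
      3 * ((3 : ℤ) ^ (α₂ + γ₂) * (a₂ * c₂)) ≡
        -((3 : ℤ) ^ (α₁ + γ₂) * (a₁ * c₂) + (3 : ℤ) ^ (α₂ + γ₁) * (a₂ * c₁))
          [ZMOD (3 : ℤ) ^ n]) := by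
  rintro ⟨e₁, e₂⟩
  have not_dvd_mul {x y : ℤ} (hx : ¬ (3 : ℤ) ∣ x) (hy : ¬ (3 : ℤ) ∣ y) : ¬ (3 : ℤ) ∣ x * y :=
    fun h => (Int.prime_three.dvd_or_dvd h).elim hx hy
  rw [← mul_assoc (3 : ℤ), ← pow_succ'] at e₁ e₂
  have hle : α₂ + γ₂ + 1 ≤ α₁ + γ₁ :=
    le_of_pow_dvd_pow_mul three_ne_zero (not_dvd_mul ha₁ hc₁)
      (((e₁.of_dvd (pow_dvd_pow 3 h₂)).dvd_iff).2 (dvd_mul_right _ _))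
  have hge : α₁ + γ₁ ≤ α₂ + γ₂ + 1 :=
    le_of_pow_dvd_pow_mul three_ne_zero (not_dvd_mul ha₂ hc₂)
      (((e₁.of_dvd (pow_dvd_pow 3 h₁.le)).dvd_iff).1 (dvd_mul_right _ _))
  have hsum : (3 : ℤ) ^ (α₂ + γ₂ + 1) ∣
      3 ^ (α₁ + γ₂) * (a₁ * c₂) + 3 ^ (α₂ + γ₁) * (a₂ * c₁) :=
    dvd_neg.1 (((e₂.of_dvd (pow_dvd_pow 3 h₂)).dvd_iff).1 (dvd_mul_right _ _))
  rcases lt_or_gt_of_ne (show α₁ + γ₂ ≠ α₂ + γ₁ by lia) with h | h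
  · have := le_of_pow_dvd_pow_mul_add_pow_mul three_ne_zero (not_dvd_mul ha₁ hc₂) _ h hsum
    lia
  · rw [add_comm (_ * _)] at hsum
    have := le_of_pow_dvd_pow_mul_add_pow_mul three_ne_zero (not_dvd_mul ha₂ hc₁) _ h hsum
    lia
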